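/- arXiv:2605.09009 — 2 statements merged into one kernel-verified Lean document; each statement's English description precedes it below -/
import Mathlib

section
/- Let S and A be finite nonempty sets, T a positive natural number, and γ ∈ (0,1). For each t ∈ {1,…,T}, let Q*_t, Q̂_t : S × A → ℝ, let π*_t, π̂_t : S → A be greedy policies for Q*_t and Q̂_t respectively (i.e., for every s, Q*_t(s, π*_t(s)) = max_{a ∈ A} Q*_t(s,a) and Q̂_t(s, π̂_t(s)) = max_{a ∈ A} Q̂_t(s,a)), and define V*_t(s) := max_{a ∈ A} Q*_t(s,a). Let (Ω, 𝔽, P) be a probability space and, for each t, let S_t : Ω → S be a random variable. Suppose the real numbers J* and Ĵ satisfy the performance-difference identity J* − Ĵ = Σ_{t=1}^{T} γ^{t−1} · E[V*_t(S_t) − Q*_t(S_t, π̂_t(S_t))]. Suppose further there exist constants C ≥ 0 and ε ≥ 0 such that for every t ∈ {1,…,T} and every π′ ∈ {π*_t, π̂_t}: E[(Q̂_t(S_t, π′(S_t)) − Q*_t(S_t, π′(S_t)))²] ≤ C·ε. Then J* − Ĵ ≤ (2(1 − γ^T)/(1 − γ)) · √(C·ε). -/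
open MeasureTheory

lemma integrable_fin_comp {S : Type*} [Fintype S] [MeasurableSpace S] [MeasurableSingletonClass S]
    {Ω : Type*} [MeasurableSpace Ω] (μ : Measure Ω) [IsProbabilityMeasure μ]
    (X : Ω → S) (hX : Measurable X) (f : S → ℝ) : Integrable (fun ω => f (X ω)) μ := by
  have : IsFiniteMeasure (μ.map X) := inferInstance
  exact (Integrable.of_finite (μ := μ.map X) (f := f)).comp_measurable hX

lemma abs_integral_fin_le {S : Type*} [Fintype S] [MeasurableSpace S] [MeasurableSingletonClass S]
    {Ω : Type*} [MeasurableSpace Ω] (μ : Measure Ω) [IsProbabilityMeasure μ]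
    (X : Ω → S) (hX : Measurable X) (f : S → ℝ) (b : ℝ) (h : ∫ ω, f (X ω) ^ 2 ∂μ ≤ b) :
    |∫ ω, f (X ω) ∂μ| ≤ Real.sqrt b := by
  apply Real.abs_le_sqrt
  refine le_trans ?_ h
  set m := ∫ ω, f (X ω) ∂μ with hm
  have i1 := integrable_fin_comp μ X hX f
  have i2 := integrable_fin_comp μ X hX (fun s => f s ^ 2)
  have h0 : ∫ ω, (2 * m * f (X ω) - m ^ 2) ∂μ ≤ ∫ ω, f (X ω) ^ 2 ∂μ := by
    apply integral_mono ((i1.const_mul _).sub (integrable_const _)) i2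
    intro ω
    show 2 * m * f (X ω) - m ^ 2 ≤ f (X ω) ^ 2
    nlinarith [sq_nonneg (f (X ω) - m)]
  rw [integral_sub (i1.const_mul _) (integrable_const _), integral_const_mul, ← hm] at h0
  simp at h0
  nlinarith

/-- **End-to-end optimality gap, discounted case `γ ∈ (0,1)`** (Proposition 4.2).
`S`, `A` finite nonempty, horizon `T > 0` (times indexed by `t : Fin T`, so `γ^{t-1}` for
`t ∈ {1,…,T}` becomes `γ^(t : ℕ)`). For each `t`, `π*_t` is greedy for `Q*_t` and `π̂_t` is
greedy for `Q̂_t`, and `V*_t(s) = max_a Q*_t(s,a)`. Given the performance-difference identity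
`J* − Ĵ = Σ_t γ^{t} E[V*_t(S_t) − Q*_t(S_t, π̂_t(S_t))]` and the on-policy calibration
condition `E[(Q̂_t(S_t,π′(S_t)) − Q*_t(S_t,π′(S_t)))²] ≤ C ε` for `π′ ∈ {π*_t, π̂_t}`,
we have `J* − Ĵ ≤ (2(1 − γ^T)/(1 − γ)) √(C ε)`. -/
theorem end_to_end_gap_discounted
    {S A : Type*} [Fintype S] [Nonempty S] [Fintype A] [Nonempty A]
    [MeasurableSpace S] [MeasurableSingletonClass S]
    {Ω : Type*} [MeasurableSpace Ω] (μ : Measure Ω) [IsProbabilityMeasure μ]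
    (T : ℕ) (hT : 0 < T) (γ : ℝ) (hγ : γ ∈ Set.Ioo (0 : ℝ) 1)
    (Qstar Qhat : Fin T → S × A → ℝ) (pistar pihat : Fin T → S → A)
    (hpistar : ∀ t s, Qstar t (s, pistar t s) = ⨆ a, Qstar t (s, a))
    (hpihat : ∀ t s, Qhat t (s, pihat t s) = ⨆ a, Qhat t (s, a))
    (St : Fin T → Ω → S) (hSt : ∀ t, Measurable (St t))
    (Jstar Jhat : ℝ)
    (hJ : Jstar - Jhat = ∑ t : Fin T, γ ^ (t : ℕ) *
      ∫ ω, ((⨆ a, Qstar t (St t ω, a)) - Qstar t (St t ω, pihat t (St t ω))) ∂μ)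
    (C ε : ℝ) (hC : 0 ≤ C) (hε : 0 ≤ ε)
    (hcal : ∀ t : Fin T, ∀ π' ∈ ({pistar t, pihat t} : Set (S → A)),
      ∫ ω, (Qhat t (St t ω, π' (St t ω)) - Qstar t (St t ω, π' (St t ω))) ^ 2 ∂μ ≤ C * ε) :
    Jstar - Jhat ≤ 2 * (1 - γ ^ T) / (1 - γ) * Real.sqrt (C * ε) := by
  obtain ⟨h0, h1⟩ := hγ
  have key : ∀ t : Fin T,
      ∫ ω, ((⨆ a, Qstar t (St t ω, a)) - Qstar t (St t ω, pihat t (St t ω))) ∂μ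
        ≤ 2 * Real.sqrt (C * ε) := by
    intro t
    let f : S → ℝ := fun s => Qhat t (s, pistar t s) - Qstar t (s, pistar t s)
    let g : S → ℝ := fun s => Qhat t (s, pihat t s) - Qstar t (s, pihat t s)
    have hf := abs_integral_fin_le μ (St t) (hSt t) f (C * ε) (hcal t (pistar t) (by simp))
    have hg := abs_integral_fin_le μ (St t) (hSt t) g (C * ε) (hcal t (pihat t) (by simp))
    have i1 := integrable_fin_comp μ (St t) (hSt t) f
    have i2 := integrable_fin_comp μ (St t) (hSt t) g
    have hle : ∫ ω, ((⨆ a, Qstar t (St t ω, a)) - Qstar t (St t ω, pihat t (St t ω))) ∂μ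
        ≤ ∫ ω, (g (St t ω) - f (St t ω)) ∂μ := by
      apply integral_mono (integrable_fin_comp μ (St t) (hSt t)
        (fun s => (⨆ a, Qstar t (s, a)) - Qstar t (s, pihat t s))) (i2.sub i1)
      intro ω
      have hb : Qhat t (St t ω, pistar t (St t ω)) ≤ Qhat t (St t ω, pihat t (St t ω)) := by
        rw [hpihat]
        exact le_ciSup (f := fun a => Qhat t (St t ω, a)) (Set.finite_range _).bddAbove _
      simp only [f, g, ← hpistar, Pi.sub_apply]
      linarith
    rw [integral_sub i2 i1] at hle
    linarith [(abs_le.1 hf).1, (abs_le.1 hg).2]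
  rw [hJ]
  calc _ ≤ ∑ t : Fin T, γ ^ (t : ℕ) * (2 * Real.sqrt (C * ε)) :=
        Finset.sum_le_sum fun t _ => mul_le_mul_of_nonneg_left (key t) (by positivity)
    _ = _ := by
      rw [← Finset.sum_mul, Fin.sum_univ_eq_sum_range (fun i => γ ^ i), geom_sum_eq h1.ne,
        ← neg_div_neg_eq, neg_sub, neg_sub]
      ring
end

section
/- Let S and A be finite nonempty sets and T a positive natural number. For each t ∈ {1,…,T}, let Q*_t, Q̂_t : S × A → ℝ, let π*_t, π̂_t : S → A be greedy policies for Q*_t and Q̂_t respectively (i.e., for every s, Q*_t(s, π*_t(s)) = max_{a ∈ A} Q*_t(s,a) and Q̂_t(s, π̂_t(s)) = max_{a ∈ A} Q̂_t(s,a)), and define V*_t(s) := max_{a ∈ A} Q*_t(s,a). Let (Ω, 𝔽, P) be a probability space and, for each t, let S_t : Ω → S be a random variable. Suppose the real numbers J* and Ĵ satisfy J* − Ĵ = Σ_{t=1}^{T} E[V*_t(S_t) − Q*_t(S_t, π̂_t(S_t))], and there exist constants C ≥ 0 and ε ≥ 0 such that for every t ∈ {1,…,T} and every π′ ∈ {π*_t,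 π̂_t}: E[(Q̂_t(S_t, π′(S_t)) − Q*_t(S_t, π′(S_t)))²] ≤ C·ε. Then J* − Ĵ ≤ 2T·√(C·ε). -/
open MeasureTheory

theorem aux_int {S : Type*} [Finite S] [MeasurableSpace S] [MeasurableSingletonClass S]
    {Ω : Type*} [MeasurableSpace Ω] (μ : Measure Ω) [IsProbabilityMeasure μ]
    (X : Ω → S) (hX : Measurable X) (g : S → ℝ) : Integrable (fun ω => g (X ω)) μ := by
  have : IsFiniteMeasure (μ.map X) := inferInstance
  exact (Integrable.of_finite (μ := μ.map X) (f := g)).comp_measurable hX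

theorem aux_l1 {S : Type*} [Finite S] [MeasurableSpace S] [MeasurableSingletonClass S]
    {Ω : Type*} [MeasurableSpace Ω] (μ : Measure Ω) [IsProbabilityMeasure μ]
    (X : Ω → S) (hX : Measurable X) (g : S → ℝ) (c : ℝ)
    (h : ∫ ω, (g (X ω)) ^ 2 ∂μ ≤ c) : ∫ ω, |g (X ω)| ∂μ ≤ Real.sqrt c := by
  apply Real.le_sqrt_of_sq_le
  refine le_trans ?_ h
  set m := ∫ ω, |g (X ω)| ∂μ with hm
  have h1 : ∫ ω, (2 * m * |g (X ω)| - m ^ 2) ∂μ ≤ ∫ ω, (g (X ω)) ^ 2 ∂μ := by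
    apply integral_mono (aux_int μ X hX (fun s => 2 * m * |g s| - m ^ 2))
      (aux_int μ X hX (fun s => g s ^ 2))
    intro ω
    have := sq_nonneg (|g (X ω)| - m)
    have h2 := sq_abs (g (X ω))
    simp only
    nlinarith
  rw [integral_sub (aux_int μ X hX (fun s => 2 * m * |g s|)) (integrable_const _),
    integral_const_mul, ← hm] at h1
  simp at h1
  nlinarith

/-- **End-to-end optimality gap, undiscounted case `γ = 1`** (Proposition 4.2).
`S`, `A` finite nonempty, horizon `T > 0` (times indexed by `t : Fin T`). For each `t`,
`π*_t` is greedy for `Q*_t` and `π̂_t` is greedy for `Q̂_t`, and `V*_t(s) = max_a Q*_t(s,a)`.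
Given the performance-difference identity
`J* − Ĵ = Σ_t E[V*_t(S_t) − Q*_t(S_t, π̂_t(S_t))]` and the on-policy calibration
condition `E[(Q̂_t(S_t,π′(S_t)) − Q*_t(S_t,π′(S_t)))²] ≤ C ε` for `π′ ∈ {π*_t, π̂_t}`,
we have `J* − Ĵ ≤ 2T √(C ε)`. -/
theorem end_to_end_gap_undiscounted
    {S A : Type*} [Fintype S] [Nonempty S] [Fintype A] [Nonempty A]
    [MeasurableSpace S] [MeasurableSingletonClass S]
    {Ω : Type*} [MeasurableSpace Ω] (μ : Measure Ω) [IsProbabilityMeasure μ]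
    (T : ℕ) (hT : 0 < T)
    (Qstar Qhat : Fin T → S × A → ℝ) (pistar pihat : Fin T → S → A)
    (hpistar : ∀ t s, Qstar t (s, pistar t s) = ⨆ a, Qstar t (s, a))
    (hpihat : ∀ t s, Qhat t (s, pihat t s) = ⨆ a, Qhat t (s, a))
    (St : Fin T → Ω → S) (hSt : ∀ t, Measurable (St t))
    (Jstar Jhat : ℝ)
    (hJ : Jstar - Jhat = ∑ t : Fin T,
      ∫ ω, ((⨆ a, Qstar t (St t ω, a)) - Qstar t (St t ω, pihat t (St t ω))) ∂μ)
    (C ε : ℝ) (hC : 0 ≤ C) (hε : 0 ≤ ε)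
    (hcal : ∀ t : Fin T, ∀ π' ∈ ({pistar t, pihat t} : Set (S → A)),
      ∫ ω, (Qhat t (St t ω, π' (St t ω)) - Qstar t (St t ω, π' (St t ω))) ^ 2 ∂μ ≤ C * ε) :
    Jstar - Jhat ≤ 2 * T * Real.sqrt (C * ε) := by
  have key : ∀ t : Fin T,
      ∫ ω, ((⨆ a, Qstar t (St t ω, a)) - Qstar t (St t ω, pihat t (St t ω))) ∂μ
        ≤ 2 * Real.sqrt (C * ε) := by
    intro t
    have h1 := aux_l1 μ (St t) (hSt t)
      (fun s => Qhat t (s, pistar t s) - Qstar t (s, pistar t s)) _ (hcal t (pistar t) (by simp))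
    have h2 := aux_l1 μ (St t) (hSt t)
      (fun s => Qhat t (s, pihat t s) - Qstar t (s, pihat t s)) _ (hcal t (pihat t) (by simp))
    have i1 := aux_int μ (St t) (hSt t)
      (fun s => |Qhat t (s, pistar t s) - Qstar t (s, pistar t s)|)
    have i2 := aux_int μ (St t) (hSt t)
      (fun s => |Qhat t (s, pihat t s) - Qstar t (s, pihat t s)|)
    have i3 := aux_int μ (St t) (hSt t)
      (fun s => (⨆ a, Qstar t (s, a)) - Qstar t (s, pihat t s))
    have h3 := integral_mono i3 (i1.add i2) (by
      intro ω
      simp only [Pi.add_apply]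
      rw [← hpistar]
      have hb : Qhat t (St t ω, pistar t (St t ω)) ≤ Qhat t (St t ω, pihat t (St t ω)) := by
        rw [hpihat]
        exact le_ciSup (f := fun a => Qhat t (St t ω, a)) (Set.finite_range _).bddAbove _
      have := neg_abs_le (Qhat t (St t ω, pistar t (St t ω)) - Qstar t (St t ω, pistar t (St t ω)))
      have := le_abs_self (Qhat t (St t ω, pihat t (St t ω)) - Qstar t (St t ω, pihat t (St t ω)))
      linarith)
    rw [integral_add' i1 i2] at h3
    linarith
  rw [hJ]
  refine (Finset.sum_le_sum fun t _ => key t).trans (le_of_eq ?_)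
  simp
  ring
end
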